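/- arXiv:1011.2811 — 4 statements merged into one kernel-verified Lean document; each statement's English description precedes it below -/
import Mathlib

section
/- Let n ≥ 1. The natural action of GL_n(ℤ) on the set of positive cones of ℤⁿ is faithful: for every A ∈ GL_n(ℤ) with A ≠ I, there exists a positive cone P ⊆ ℤⁿ such that A(P) ≠ P (where A(P) denotes the image of P under the linear action of A on ℤⁿ). -/
open Pointwise

/-- A positive cone on the free abelian group `ℤⁿ`: a subset `P` with
`P + P ⊆ P`, `P ∩ (−P) = ∅` and `P ∪ (−P) = ℤⁿ \ {0}`. -/
def IsPosCone {n : ℕ} (P : Set (Fin n → ℤ)) : Prop :=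
  P + P ⊆ P ∧ P ∩ (-P) = ∅ ∧ P ∪ (-P) = {(0 : Fin n → ℤ)}ᶜ

theorem isPosCone_preimage_Ioi {n : ℕ} {G : Type*} [AddCommGroup G] [LinearOrder G]
    [IsOrderedAddMonoid G] (f : (Fin n → ℤ) →+ G) (hf : Function.Injective f) :
    IsPosCone {w | 0 < f w} := by
  refine ⟨?_, ?_, ?_⟩
  · rintro _ ⟨a, ha, b, hb, rfl⟩
    simp only [Set.mem_ofPred_eq, map_add] at *
    exact add_pos ha hb
  · ext w
    simp only [Set.mem_inter_iff, Set.mem_neg, Set.mem_ofPred_eq, map_neg, Left.neg_pos_iff,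
      Set.mem_empty_iff_false, iff_false, not_and]
    exact fun h => not_lt_of_gt h
  · ext w
    simp only [Set.mem_union, Set.mem_neg, Set.mem_ofPred_eq, map_neg, Left.neg_pos_iff,
      Set.mem_compl_iff, Set.mem_singleton_iff]
    rw [← map_eq_zero_iff f hf, ← ne_eq, ne_iff_lt_or_gt, or_comm]

/-- The embedding of `ℤⁿ` into a lexicographic product that compares vectors by the functional `φ`
first and breaks ties lexicographically. -/
def lexRefinement {n : ℕ} (φ : (Fin n → ℤ) →+ ℤ) : (Fin n → ℤ) →+ ℤ ×ₗ Lex (Fin n → ℤ) where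
  toFun w := toLex (φ w, toLex w)
  map_zero' := by rw [map_zero]; rfl
  map_add' a b := by rw [map_add]; rfl

theorem lexRefinement_injective {n : ℕ} (φ : (Fin n → ℤ) →+ ℤ) :
    Function.Injective (lexRefinement φ) := fun _ _ h =>
  congrArg (fun p : ℤ ×ₗ Lex (Fin n → ℤ) => ofLex (ofLex p).2) h

theorem exists_isPosCone_of_pos_of_neg {n : ℕ} (φ : (Fin n → ℤ) →+ ℤ) {v u : Fin n → ℤ}
    (hv : 0 < φ v) (hu : φ u < 0) : ∃ P : Set (Fin n → ℤ), IsPosCone P ∧ v ∈ P ∧ u ∉ P := by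
  have hv' : 0 < lexRefinement φ v := Prod.Lex.toLex_lt_toLex.2 (.inl hv)
  have hu' : lexRefinement φ u < 0 := Prod.Lex.toLex_lt_toLex.2 (.inl hu)
  exact ⟨_, isPosCone_preimage_Ioi _ (lexRefinement_injective φ), hv', hu'.not_gt⟩

theorem exists_isPosCone_of_minor_ne_zero {n : ℕ} {v u : Fin n → ℤ} {i j : Fin n}
    (h : v i * u j - v j * u i ≠ 0) :
    ∃ P : Set (Fin n → ℤ), IsPosCone P ∧ v ∈ P ∧ u ∉ P := by
  let φ : (Fin n → ℤ) →+ ℤ :=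
    { toFun := fun w => (v i * u j - v j * u i) * ((w i * u j - w j * u i) - (v i * w j - v j * w i))
      map_zero' := by simp
      map_add' := fun a b => by simp only [Pi.add_apply]; ring }
  have hpos := pow_pos (abs_pos.2 h) 2
  rw [sq_abs] at hpos
  refine exists_isPosCone_of_pos_of_neg φ ?_ ?_
  · change 0 < (v i * u j - v j * u i) * _
    linarith
  · change (v i * u j - v j * u i) * _ < 0
    linarith

/-- Lemma 3.1: `GL_n(ℤ)` acts faithfully on the space of orderings of `ℤⁿ`. -/
theorem GL_acts_faithfully_on_orderings (n : ℕ) (hn : 1 ≤ n)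
    (A : GL (Fin n) ℤ) (hA : A ≠ 1) :
    ∃ P : Set (Fin n → ℤ), IsPosCone P ∧
      (fun v => (A : Matrix (Fin n) (Fin n) ℤ).mulVec v) '' P ≠ P := by
  suffices h : ∃ v, ∃ P : Set (Fin n → ℤ), IsPosCone P ∧ v ∈ P ∧
      (A : Matrix (Fin n) (Fin n) ℤ).mulVec v ∉ P by
    obtain ⟨v, P, hP, hv, hAv⟩ := h
    exact ⟨P, hP, fun h => hAv (h ▸ Set.mem_image_of_mem _ hv)⟩
  by_cases hdiag : ∃ i j, i ≠ j ∧ (A : Matrix (Fin n) (Fin n) ℤ) j i ≠ 0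
  · obtain ⟨i, j, hij, h⟩ := hdiag
    refine ⟨Pi.single i 1, exists_isPosCone_of_minor_ne_zero (i := i) (j := j) ?_⟩
    simpa [hij.symm] using h
  push Not at hdiag
  have hunit (i : Fin n) : IsUnit ((A : Matrix (Fin n) (Fin n) ℤ) i i) := by
    have h := congrFun (congrFun A.mul_inv i) i
    rw [Matrix.mul_apply, Finset.sum_eq_single i
      (fun k _ hk => by rw [hdiag k i hk, zero_mul]) (by simp), Matrix.one_apply_eq] at h
    exact IsUnit.of_mul_eq_one _ h
  obtain ⟨i, hi⟩ : ∃ i, (A : Matrix (Fin n) (Fin n) ℤ) i i ≠ 1 := by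
    by_contra! hone
    refine hA (Units.ext (Matrix.ext fun i j => ?_))
    rcases eq_or_ne i j with rfl | hij
    · simp [hone]
    · simp [hdiag j i hij.symm, hij]
  have hneg := (Int.isUnit_iff.1 (hunit i)).resolve_left hi
  exact ⟨Pi.single i 1, exists_isPosCone_of_pos_of_neg (Pi.evalAddMonoidHom _ i)
    (by simp) (by simp [hneg])⟩
end

section
/- Let n ≥ 1, let P be a positive cone on ℤⁿ, and let F ⊆ P be a finite subset. Then there exists an invertible matrix M ∈ GL_n(ℚ) such that for every v ∈ F, the vector Mv ∈ ℚⁿ is lexicographically positive, i.e., its first nonzero coordinate is positive. (Consequently, the flag orderings — the orderings of ℤⁿ obtained by pulling back the lexicographic order along a rational linear isomorphism — are dense in the space of all orderings of ℤⁿ.) -/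
open Pointwise

/-- A vector of `ℚⁿ` is lexicographically positive if its first nonzero coordinate
is positive. -/
def LexPos {n : ℕ} (w : Fin n → ℚ) : Prop :=
  ∃ i : Fin n, 0 < w i ∧ ∀ j : Fin n, j < i → w j = 0

/-- The natural embedding of `ℤⁿ` into `ℚⁿ`. -/
def intVecToRat {n : ℕ} (v : Fin n → ℤ) : Fin n → ℚ := fun j => (v j : ℚ)

/-- A linear functional that is positive on a finite set `T` and nonnegative at `a` can be
perturbed to be positive on `T` and at `a`, given a functional that is positive at `a`. -/
theorem exists_dual_pos_perturb {K V : Type*} [Field K] [LinearOrder K] [IsStrictOrderedRing K]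
    [AddCommGroup V] [Module K V] (T : Finset V) (a : V) (g k : V →ₗ[K] K)
    (hg : ∀ t ∈ T, 0 < g t) (hga : 0 ≤ g a) (hk : 0 < k a) :
    ∃ f : V →ₗ[K] K, 0 < f a ∧ ∀ t ∈ T, 0 < f t := by
  have h : ∀ᶠ N : K in Filter.atTop, ∀ t ∈ T, 0 < N * g t + k t := by
    rw [Filter.eventually_all_finset]
    intro t ht
    filter_upwards [Filter.eventually_gt_atTop (-k t / g t)] with N hN
    rw [div_lt_iff₀ (hg t ht)] at hN
    linarith
  obtain ⟨N, hN, hN0⟩ := (h.and (Filter.eventually_ge_atTop 0)).exists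
  exact ⟨N • g + k, by simpa using add_pos_of_nonneg_of_pos (mul_nonneg hN0 hga) hk,
    fun t ht => by simpa using hN t ht⟩

/-- Every finite subset of a convex cone not containing `0` lies in an open half-space. -/
theorem ConvexCone.exists_dual_pos {K V : Type*} [Field K] [LinearOrder K] [IsStrictOrderedRing K]
    [AddCommGroup V] [Module K V] (C : ConvexCone K V) (hC : (0 : V) ∉ C)
    (S : Finset V) (hS : ∀ v ∈ S, v ∈ C) :
    ∃ f : V →ₗ[K] K, ∀ v ∈ S, 0 < f v := by
  classical
  induction hm : S.card using Nat.strong_induction_on generalizing S with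
  | _ m ih =>
    subst hm
    obtain rfl | ⟨a, haS⟩ := S.eq_empty_or_nonempty
    · exact ⟨0, by simp⟩
    set T := S.erase a
    have hTS : T.card < S.card := Finset.card_erase_lt_of_mem haS
    have hTC : ∀ t ∈ T, t ∈ C := fun t ht => hS t (Finset.mem_of_mem_erase ht)
    suffices ∃ f : V →ₗ[K] K, 0 < f a ∧ ∀ t ∈ T, 0 < f t by
      obtain ⟨f, hfa, hfT⟩ := this
      refine ⟨f, fun v hv => ?_⟩
      obtain rfl | hva := eq_or_ne v a
      · exact hfa
      · exact hfT v (Finset.mem_erase.2 ⟨hva, hv⟩)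
    obtain ⟨f, hf⟩ := ih _ hTS T hTC rfl
    rcases lt_trichotomy (f a) 0 with hfa | hfa | hfa
    · -- The projection along `a` onto the kernel of `f` maps `T` into `C`.
      let π : V →ₗ[K] V := LinearMap.id - (f a)⁻¹ • f.smulRight a
      have hπ (x : V) : π x = x + (-((f a)⁻¹ * f x)) • a := by
        simp [π, smul_smul, sub_eq_add_neg]
      have hπT : ∀ w ∈ T.image π, w ∈ C := by
        simp only [Finset.mem_image, forall_exists_index, and_imp, forall_apply_eq_imp_iff₂]
        intro t ht
        rw [hπ]
        refine C.add_mem (hTC t ht) (C.smul_mem ?_ (hS a haS))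
        exact neg_pos.2 (mul_neg_of_neg_of_pos (inv_lt_zero.2 hfa) (hf t ht))
      obtain ⟨g, hg⟩ := ih _ (Finset.card_image_le.trans_lt hTS) (T.image π) hπT rfl
      have hπa : π a = 0 := by simp [hπ, hfa.ne]
      exact exists_dual_pos_perturb T a (g ∘ₗ π) (-f)
        (fun t ht => hg _ (Finset.mem_image_of_mem π ht)) (by simp [hπa]) (by simpa using hfa)
    · have ha : a ≠ 0 := fun h => hC (h ▸ hS a haS)
      obtain ⟨k, hk⟩ := Module.Projective.exists_dual_eq_one K ha
      exact exists_dual_pos_perturb T a f k hf hfa.ge (by simp [hk])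
    · exact ⟨f, hfa, hf⟩

/-- A nonzero vector can be placed as any prescribed row of an invertible matrix. -/
theorem Matrix.exists_GL_row_eq {ι K : Type*} [Fintype ι] [DecidableEq ι] [Field K]
    (c : ι → K) (hc : c ≠ 0) (i : ι) : ∃ M : GL ι K, (M : Matrix ι ι K) i = c := by
  obtain ⟨j, hj⟩ := Function.ne_iff.1 hc
  have hdet : ((1 : Matrix ι ι K).updateRow j c).det = c j := by
    rw [← Matrix.det_transpose, ← Matrix.updateCol_transpose, Matrix.transpose_one,
      ← Matrix.cramer_apply, Matrix.cramer_one]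
    rfl
  refine ⟨Matrix.GeneralLinearGroup.mkOfDetNeZero
    (((1 : Matrix ι ι K).updateRow j c).submatrix (Equiv.swap i j) id) ?_, ?_⟩
  · rw [Matrix.det_permute, hdet]
    refine mul_ne_zero ?_ hj
    rcases Int.units_eq_one_or (Equiv.Perm.sign (Equiv.swap i j)) with h | h <;> simp [h]
  · ext l
    simp [Matrix.GeneralLinearGroup.mkOfDetNeZero]

namespace IsPosCone

variable {n : ℕ} {P : Set (Fin n → ℤ)}

theorem add_mem (hP : IsPosCone P) {v w : Fin n → ℤ} (hv : v ∈ P) (hw : w ∈ P) : v + w ∈ P :=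
  hP.1 (Set.add_mem_add hv hw)

theorem zero_notMem (hP : IsPosCone P) : (0 : Fin n → ℤ) ∉ P := fun h =>
  Set.eq_empty_iff_forall_notMem.1 hP.2.1 0 ⟨h, by simpa using h⟩

theorem nsmul_mem (hP : IsPosCone P) {v : Fin n → ℤ} (hv : v ∈ P) {m : ℕ} (hm : 0 < m) :
    m • v ∈ P := by
  induction m, hm using Nat.le_induction with
  | base => simpa using hv
  | succ k _ ih => simpa [add_smul] using hP.add_mem ih hv

/-- The rational convex cone of the vectors having a positive multiple in `P`. -/
def ratCone (hP : IsPosCone P) : ConvexCone ℚ (Fin n → ℚ) where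
  carrier := {w | ∃ m : ℕ, 0 < m ∧ ∃ v ∈ P, m • w = intVecToRat v}
  smul_mem' := by
    rintro c hc w ⟨m, hm, v, hv, h⟩
    refine ⟨c.den * m, Nat.mul_pos c.den_pos hm, c.num.toNat • v,
      hP.nsmul_mem hv (by simpa using hc), ?_⟩
    ext j
    have hj : (m : ℚ) * w j = v j := by simpa [intVecToRat] using congrFun h j
    have hnum : ((c.num.toNat : ℤ) : ℚ) = c.num := by
      rw [Int.toNat_of_nonneg (Rat.num_nonneg.2 hc.le)]
    have hden : (c.den : ℚ) * c = c.num := Rat.den_mul_eq_num c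
    simp only [Pi.smul_apply, intVecToRat, nsmul_eq_mul, smul_eq_mul, Nat.cast_mul, Int.cast_mul,
      hnum, ← hj, ← hden]
    ring
  add_mem' := by
    rintro w ⟨m, hm, v, hv, h⟩ w' ⟨m', hm', v', hv', h'⟩
    refine ⟨m * m', Nat.mul_pos hm hm', m' • v + m • v',
      hP.add_mem (hP.nsmul_mem hv hm') (hP.nsmul_mem hv' hm), ?_⟩
    ext j
    have hj : (m : ℚ) * w j = v j := by simpa [intVecToRat] using congrFun h j
    have hj' : (m' : ℚ) * w' j = v' j := by simpa [intVecToRat] using congrFun h' j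
    simp only [Pi.smul_apply, Pi.add_apply, intVecToRat]
    simp only [nsmul_eq_mul, Nat.cast_mul, Int.cast_add, Int.cast_mul, Int.cast_natCast,
      ← hj, ← hj']
    ring

theorem zero_notMem_ratCone (hP : IsPosCone P) : (0 : Fin n → ℚ) ∉ hP.ratCone := by
  rintro ⟨m, -, v, hv, h⟩
  have hv0 : v = 0 := by
    ext j
    simpa [intVecToRat, eq_comm] using congrFun h j
  exact hP.zero_notMem (hv0 ▸ hv)

theorem intVecToRat_mem_ratCone (hP : IsPosCone P) {v : Fin n → ℤ} (hv : v ∈ P) :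
    intVecToRat v ∈ hP.ratCone :=
  ⟨1, one_pos, v, hv, one_smul _ _⟩

end IsPosCone

/-- Proposition 3.3 (density of flag orderings): given a positive cone `P` on `ℤⁿ` and a
finite subset `F ⊆ P`, there is `M ∈ GL_n(ℚ)` making every vector of `F`
lexicographically positive. -/
theorem flag_orderings_dense (n : ℕ) (hn : 1 ≤ n)
    (P : Set (Fin n → ℤ)) (hP : IsPosCone P)
    (F : Set (Fin n → ℤ)) (hFP : F ⊆ P) (hF : F.Finite) :
    ∃ M : GL (Fin n) ℚ, ∀ v ∈ F,
      LexPos ((M : Matrix (Fin n) (Fin n) ℚ).mulVec (intVecToRat v)) := by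
  obtain rfl | ⟨v₀, hv₀⟩ := F.eq_empty_or_nonempty
  · exact ⟨1, by simp⟩
  obtain ⟨f, hf⟩ := hP.ratCone.exists_dual_pos hP.zero_notMem_ratCone
    (hF.toFinset.image intVecToRat) (by
      simpa using fun v hv => hP.intVecToRat_mem_ratCone (hFP hv))
  replace hf : ∀ v ∈ F, 0 < f (intVecToRat v) := by simpa using hf
  set c : Fin n → ℚ := fun j => f fun i => if j = i then 1 else 0
  have hfc (w : Fin n → ℚ) : f w = c ⬝ᵥ w := by
    rw [LinearMap.pi_apply_eq_sum_univ f w]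
    simp [dotProduct, c, mul_comm]
  have hc : c ≠ 0 := by
    intro h
    have := hf v₀ hv₀
    simp [hfc, h] at this
  obtain ⟨M, hM⟩ := Matrix.exists_GL_row_eq c hc ⟨0, hn⟩
  refine ⟨M, fun v hv => ⟨⟨0, hn⟩, ?_, fun j hj => absurd hj (Nat.not_lt_zero _)⟩⟩
  rw [Matrix.mulVec, hM, ← hfc]
  exact hf v hv
end

section
/- Let N be a finitely generated nilpotent group. Then the set T(N) of elements of finite order in N is a finite normal subgroup of N, and the quotient N/T(N) is torsion-free. -/
open scoped commutatorElement IsMulCommutative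

namespace Subgroup

variable {G H : Type*} [Group G] [Group H]

theorem exists_fg_le_map_eq (f : G →* H) (P : Subgroup G) (h : (P.map f).FG) :
    ∃ Q ≤ P, Q.FG ∧ Q.map f = P.map f := by
  obtain ⟨S, hS, hfin⟩ := (fg_iff _).1 h
  have hsub : S ⊆ f '' P := by
    rw [← coe_map, ← hS]
    exact subset_closure
  obtain ⟨A, hAP, hA, rfl⟩ := Set.exists_subset_image_finite_and.1 ⟨S, hsub, hfin, rfl⟩
  exact ⟨closure A, (closure_le P).2 hAP, (fg_iff _).2 ⟨A, rfl, hA⟩, by rw [f.map_closure, hS]⟩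

theorem FG.of_map_of_inf_ker (f : G →* H) {P : Subgroup G} (h : (P.map f).FG)
    (hker : (P ⊓ f.ker).FG) : P.FG := by
  obtain ⟨Q, hQP, hQ, hmap⟩ := exists_fg_le_map_eq f P h
  have hP : P = Q ⊔ P ⊓ f.ker := by
    refine le_antisymm (fun p hp ↦ ?_) (sup_le hQP inf_le_left)
    obtain ⟨q, hq, hqp⟩ : f p ∈ Q.map f := hmap ▸ mem_map_of_mem f hp
    rw [← mul_inv_cancel_left q p]
    refine mul_mem_sup hq (mem_inf.2 ⟨mul_mem (inv_mem (hQP hq)) hp, ?_⟩)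
    simp [MonoidHom.mem_ker, hqp]
  rw [hP]
  exact hQ.sup hker

theorem FG.of_le_of_le_center {K L : Subgroup G} (hK : K.FG) (hcenter : K ≤ center G)
    (hL : L ≤ K) : L.FG := by
  have : Group.FG K := (Group.fg_iff_subgroup_fg K).2 hK
  let _ : CommGroup K :=
    { (inferInstance : Group K) with
      mul_comm := fun a b ↦ Subtype.ext (mem_center_iff.1 (hcenter b.2) a) }
  have : Module.Finite ℤ (Additive K) := Module.Finite.iff_addGroup_fg.2 inferInstance
  have h : (L.subgroupOf K).FG := by
    rw [fg_iff_add_fg, ← AddSubgroup.toIntSubmodule_toAddSubgroup (L.subgroupOf K).toAddSubgroup,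
      ← Submodule.fg_iff_addSubgroup_fg]
    exact IsNoetherian.noetherian _
  rw [← map_subgroupOf_eq_of_le hL]
  rw [fg_iff_submonoid_fg] at h ⊢
  exact h.map K.subtype

theorem isOfFinOrder_of_mem_closure {S : Set G} (hcenter : S ⊆ center G)
    (hS : ∀ s ∈ S, IsOfFinOrder s) {g : G} (hg : g ∈ closure S) : IsOfFinOrder g := by
  induction hg using closure_induction with
  | mem x hx => exact hS x hx
  | one => exact .one
  | mul x y _ hy hx' hy' =>
    exact Commute.isOfFinOrder_mul (mem_center_iff.1 ((closure_le _).2 hcenter hy) x) hx' hy'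
  | inv x _ hx => exact hx.inv

theorem isOfFinOrder_commutatorElement {x g : G} (hxg : ⁅x, g⁆ ∈ center G) {k : ℕ} (hk : 0 < k)
    (hx : x ^ k ∈ center G) : IsOfFinOrder ⁅x, g⁆ := by
  rw [isOfFinOrder_iff_pow_eq_one]
  refine ⟨k, hk, ?_⟩
  have hcomm : Commute ⁅x, g⁆ (g * x * g⁻¹) := (mem_center_iff.1 hxg _).symm
  have hpow : x ^ k = ⁅x, g⁆ ^ k * (g * x * g⁻¹) ^ k := by
    rw [← hcomm.mul_pow]
    congr 1
    simp [commutatorElement_def, mul_assoc]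
  rw [conj_pow, mem_center_iff.1 hx g, mul_inv_cancel_right] at hpow
  exact right_eq_mul.1 hpow

/-- If commutators of a set `A` with generators of `G` lie in a normal subgroup `K`, then so do the
commutators of `A` modulo the center with `G`. -/
theorem commutator_le_of_closure {A S : Set G} (hS : closure S = ⊤) {K P : Subgroup G} [K.Normal]
    (hP : P ≤ closure A ⊔ center G) (hK : ∀ a ∈ A, ∀ s ∈ S, ⁅a, s⁆ ∈ K) : ⁅P, ⊤⁆ ≤ K := by
  have hcomm (a b : G) : ⁅a, b⁆ ∈ K ↔ Commute (a : G ⧸ K) b := by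
    rw [← commutatorElement_eq_one_iff_commute, ← QuotientGroup.eq_one_iff]
    rfl
  let C := (center (G ⧸ K)).comap (QuotientGroup.mk' K)
  have hC (a : G) : a ∈ C ↔ ∀ g, ⁅a, g⁆ ∈ K := by
    simp only [hcomm, C, mem_comap, mem_center_iff, QuotientGroup.mk'_apply]
    rw [QuotientGroup.forall_mk]
    exact forall_congr' fun g ↦ eq_comm
  have hPC : P ≤ C := by
    refine hP.trans (sup_le ((closure_le _).2 fun a ha ↦ (hC a).2 fun g ↦ ?_) fun a ha ↦ ?_)
    · have hle : closure S ≤ (centralizer {(a : G ⧸ K)}).comap (QuotientGroup.mk' K) := by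
        refine (closure_le _).2 fun s hs ↦ ?_
        simpa [mem_centralizer_singleton_iff] using ((hcomm a s).1 (hK a ha s hs)).eq.symm
      have hg := hle (hS ▸ mem_top g)
      simp only [mem_comap, mem_centralizer_singleton_iff, QuotientGroup.mk'_apply] at hg
      exact (hcomm a g).2 hg.symm
    · refine (hC a).2 fun g ↦ ?_
      rw [commutatorElement_eq_one_iff_mul_comm.2 (mem_center_iff.1 ha g).symm]
      exact one_mem K
  exact commutator_le.2 fun a ha g _ ↦ (hC a).1 (hPC ha) g

theorem lowerCentralSeries_quotient_eq_bot (n : ℕ) :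
    (⊤ : Subgroup (G ⧸ (⊤ : Subgroup G).lowerCentralSeries n)).lowerCentralSeries n = ⊥ := by
  rw [← map_top_of_surjective _ (QuotientGroup.mk'_surjective _), ← map_lowerCentralSeries,
    map_eq_bot_iff, QuotientGroup.ker_mk']

theorem lowerCentralSeries_le_center {n : ℕ}
    (h : (⊤ : Subgroup G).lowerCentralSeries (n + 1) = ⊥) :
    (⊤ : Subgroup G).lowerCentralSeries n ≤ center G :=
  commutator_top_right_eq_bot_iff_le_center.1 h

end Subgroup

namespace Group

open Subgroup

theorem fg_lowerCentralSeries_of_quotient {G : Type*} [Group G] [FG G] {n : ℕ}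
    (hcenter : (⊤ : Subgroup G).lowerCentralSeries (n + 1) ≤ center G)
    (h : (((⊤ : Subgroup G).lowerCentralSeries n).map
      (QuotientGroup.mk' ((⊤ : Subgroup G).lowerCentralSeries (n + 1)))).FG) :
    ((⊤ : Subgroup G).lowerCentralSeries (n + 1)).FG := by
  set Z := (⊤ : Subgroup G).lowerCentralSeries (n + 1)
  set P := (⊤ : Subgroup G).lowerCentralSeries n
  obtain ⟨Q, hQP, hQ, hmap⟩ := exists_fg_le_map_eq _ P h
  obtain ⟨A, rfl, hA⟩ := (Subgroup.fg_iff Q).1 hQ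
  obtain ⟨S, hS, hSfin⟩ := Group.fg_iff.1 ‹FG G›
  have hKZ : closure (Set.image2 (fun a s ↦ ⁅a, s⁆) A S) ≤ Z := by
    refine (closure_le _).2 ?_
    rintro _ ⟨a, ha, s, -, rfl⟩
    exact commutator_mem_commutator (hQP (subset_closure ha)) (mem_top s)
  have hnormal : (closure (Set.image2 (fun a s ↦ ⁅a, s⁆) A S)).Normal :=
    ⟨fun k hk g ↦ by rwa [mem_center_iff.1 (hcenter (hKZ hk)) g, mul_inv_cancel_right]⟩
  refine (Subgroup.fg_iff Z).2 ⟨_, le_antisymm hKZ ?_, hA.image2 _ hSfin⟩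
  refine commutator_le_of_closure hS ?_ fun a ha s hs ↦
    subset_closure (Set.mem_image2_of_mem ha hs)
  have hle : P ≤ closure A ⊔ Z := by
    have := map_le_iff_le_comap.1 hmap.ge
    rwa [comap_map_eq, QuotientGroup.ker_mk'] at this
  exact hle.trans (sup_le_sup_left hcenter _)

/-- Every subgroup of a finitely generated nilpotent group is finitely generated. -/
theorem IsNilpotent.subgroup_fg {G : Type*} [Group G] [IsNilpotent G] [FG G] (H : Subgroup G) :
    H.FG := by
  obtain ⟨n, hn⟩ := Subgroup.nilpotent_iff_lowerCentralSeries.1 ‹IsNilpotent G›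
  replace hn : (⊤ : Subgroup G).lowerCentralSeries (n + 1) = ⊥ :=
    le_bot_iff.1 (hn ▸ Subgroup.lowerCentralSeries_antitone ⊤ n.le_succ)
  induction n generalizing G with
  | zero =>
    exact FG.of_le_of_le_center (Group.fg_def.1 ‹FG G›) (lowerCentralSeries_le_center hn) le_top
  | succ n ih =>
    have hcenter := lowerCentralSeries_le_center hn
    have hquot := fun L ↦ ih L (lowerCentralSeries_quotient_eq_bot (G := G) (n + 1))
    refine FG.of_map_of_inf_ker
      (QuotientGroup.mk' ((⊤ : Subgroup G).lowerCentralSeries (n + 1))) (hquot _) ?_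
    rw [QuotientGroup.ker_mk']
    exact FG.of_le_of_le_center (fg_lowerCentralSeries_of_quotient hcenter (hquot _)) hcenter
      inf_le_right

/-- A nilpotent group generated by elements of finite order is a torsion group. -/
theorem IsNilpotent.isMulTorsion_of_closure {G : Type*} [Group G] [IsNilpotent G] {S : Set G}
    (hS : closure S = ⊤) (htors : ∀ s ∈ S, IsOfFinOrder s) : IsMulTorsion G := by
  obtain ⟨n, hn⟩ := Subgroup.nilpotent_iff_lowerCentralSeries.1 ‹IsNilpotent G›
  replace hn : (⊤ : Subgroup G).lowerCentralSeries (n + 1) = ⊥ :=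
    le_bot_iff.1 (hn ▸ Subgroup.lowerCentralSeries_antitone ⊤ n.le_succ)
  induction n generalizing G with
  | zero =>
    exact fun g ↦ isOfFinOrder_of_mem_closure
      (fun s _ ↦ lowerCentralSeries_le_center hn (mem_top s)) htors (hS ▸ mem_top g)
  | succ n ih =>
    have hcenter := lowerCentralSeries_le_center hn
    set Z := (⊤ : Subgroup G).lowerCentralSeries (n + 1)
    have hquot : IsMulTorsion (G ⧸ Z) := by
      refine ih (S := QuotientGroup.mk' Z '' S) ?_ ?_ (lowerCentralSeries_quotient_eq_bot (n + 1))
      · rw [← MonoidHom.map_closure, hS,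
          map_top_of_surjective _ (QuotientGroup.mk'_surjective Z)]
      · rintro _ ⟨s, hs, rfl⟩
        exact (QuotientGroup.mk' Z).isOfFinOrder (htors s hs)
    refine hquot.extension_closed (QuotientGroup.ker_mk' Z).symm fun z ↦ ?_
    rw [← Submonoid.isOfFinOrder_coe]
    have hmem (x : G) (hx : x ∈ (⊤ : Subgroup G).lowerCentralSeries n) (g : G) : ⁅x, g⁆ ∈ Z :=
      commutator_mem_commutator hx (mem_top g)
    refine isOfFinOrder_of_mem_closure ?_ ?_ ((Subgroup.mem_lowerCentralSeries_succ_iff ⊤ n (z : G)).1 z.2)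
    · rintro _ ⟨x, hx, g, -, rfl⟩
      exact hcenter (hmem x hx g)
    · rintro _ ⟨x, hx, g, -, rfl⟩
      obtain ⟨k, hk, hxk⟩ := (hquot (x : G ⧸ Z)).exists_pow_eq_one
      rw [← QuotientGroup.mk_pow, QuotientGroup.eq_one_iff] at hxk
      exact isOfFinOrder_commutatorElement (hcenter (hmem x hx g)) hk (hcenter hxk)

theorem IsNilpotent.isOfFinOrder_mul {G : Type*} [Group G] [IsNilpotent G] {a b : G}
    (ha : IsOfFinOrder a) (hb : IsOfFinOrder b) : IsOfFinOrder (a * b) := by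
  have htors : IsMulTorsion (closure {a, b}) := by
    refine isMulTorsion_of_closure (closure_closure_coe_preimage (k := {a, b})) fun s hs ↦ ?_
    rw [← Submonoid.isOfFinOrder_coe]
    obtain h | h := hs
    · rwa [h]
    · rwa [h]
  have hmem : a * b ∈ closure {a, b} :=
    mul_mem (subset_closure (by simp)) (subset_closure (by simp))
  exact Submonoid.isOfFinOrder_coe.2 (htors ⟨a * b, hmem⟩)

theorem IsNilpotent.finite_of_fg_isMulTorsion {G : Type*} [Group G] [IsNilpotent G] [FG G]
    (h : IsMulTorsion G) : Finite G := by
  suffices FG G → IsMulTorsion G → Finite G from this ‹_› h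
  refine nilpotent_center_quotient_ind (P := fun G _ _ ↦ FG G → IsMulTorsion G → Finite G) G
    (fun G _ _ _ _ ↦ inferInstance) fun G _ _ ih _ htors ↦ ?_
  have : FG (center G) := (Group.fg_iff_subgroup_fg _).2 (subgroup_fg _)
  have : Finite (center G) := CommGroup.finite_of_fg_isMulTorsion _ (htors.subgroup _)
  have : Finite (G ⧸ center G) :=
    ih inferInstance (htors.of_surjective (QuotientGroup.mk'_surjective _))
  exact Finite.of_subgroup_quotient (center G)

end Group

/-- Lemma 4.4: in a finitely generated nilpotent group `N`, the elements of finite order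
form a finite normal subgroup `T(N)`, and the quotient `N/T(N)` is torsion-free (expressed
here by the fact that any root of an element of `T(N)` already lies in `T(N)`). -/
theorem torsion_subgroup_of_fg_nilpotent {N : Type*} [Group N]
    (hfg : Group.FG N) (hnil : Group.IsNilpotent N) :
    ∃ T : Subgroup N, T.Normal ∧ (T : Set N).Finite ∧
      (∀ g : N, g ∈ T ↔ ∃ k : ℕ, 0 < k ∧ g ^ k = 1) ∧
      (∀ g : N, ∀ k : ℕ, 0 < k → g ^ k ∈ T → g ∈ T) := by
  let T : Subgroup N :=
    { carrier := {g | IsOfFinOrder g}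
      one_mem' := .one
      mul_mem' := Group.IsNilpotent.isOfFinOrder_mul
      inv_mem' := IsOfFinOrder.inv }
  have : Group.FG T := (Group.fg_iff_subgroup_fg T).2 (Group.IsNilpotent.subgroup_fg T)
  have htors : IsMulTorsion T := fun t ↦ Submonoid.isOfFinOrder_coe.1 t.2
  have : Finite T := Group.IsNilpotent.finite_of_fg_isMulTorsion htors
  refine ⟨T, ⟨fun t ht g ↦ (MulAut.conj g).toMonoidHom.isOfFinOrder ht⟩,
    Set.toFinite _, fun g ↦ isOfFinOrder_iff_pow_eq_one, fun g k hk hg ↦ ?_⟩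
  exact hg.of_pow hk.ne'
end

section
/- Let K = ⟨x, y | x⁻¹yx = y⁻¹⟩ be the fundamental group of the Klein bottle. Then Aut(K) does not act faithfully on the set of left-invariant positive cones of K: there exists a group automorphism φ of K with φ ≠ id such that φ(P) = P for every left-invariant positive cone P ⊆ K. -/
open Pointwise

/-- A left-invariant positive cone on a group `G`. -/
def IsLeftInvariantCone {G : Type*} [Group G] (P : Set G) : Prop :=
  P * P ⊆ P ∧ P ∩ P⁻¹ = ∅ ∧ P ∪ P⁻¹ = {(1 : G)}ᶜ

/-- The single relator `x⁻¹yxy` of the Klein bottle group `⟨x, y ∣ x⁻¹yx = y⁻¹⟩`,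
where `x = FreeGroup.of true` and `y = FreeGroup.of false`. -/
def kleinRels : Set (FreeGroup Bool) :=
  {(FreeGroup.of true)⁻¹ * FreeGroup.of false * FreeGroup.of true * FreeGroup.of false}

/-- The fundamental group `K = ⟨x, y ∣ x⁻¹yx = y⁻¹⟩` of the Klein bottle. -/
abbrev KleinGroup := PresentedGroup kleinRels

section KleinRelation

variable {G : Type*} [Group G] {x y : G}

theorem zpow_mul_of_inverting (h : y * x = x * y⁻¹) (n : ℤ) : y ^ n * x = x * y ^ (-n) := by
  have hs : SemiconjBy x y⁻¹ y := h.symm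
  simpa using (hs.zpow_right n).eq.symm

theorem inverting_inv (h : y * x = x * y⁻¹) : y * x⁻¹ = x⁻¹ * y⁻¹ := by
  rw [mul_inv_eq_iff_eq_mul, mul_assoc, eq_inv_mul_iff_mul_eq, eq_inv_mul_iff_mul_eq,
    ← mul_assoc, h, inv_mul_cancel_right]

theorem exists_zpow_mul_zpow (h : y * x = x * y⁻¹) (n a : ℤ) :
    ∃ m : ℤ, y ^ n * x ^ a = x ^ a * y ^ m := by
  induction a using Int.induction_on generalizing n with
  | zero => exact ⟨n, by simp⟩
  | succ k ih =>
    obtain ⟨m, hm⟩ := ih n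
    exact ⟨-m, by rw [zpow_add_one, ← mul_assoc, hm, mul_assoc, zpow_mul_of_inverting h,
      mul_assoc]⟩
  | pred k ih =>
    obtain ⟨m, hm⟩ := ih n
    exact ⟨-m, by rw [zpow_sub_one, ← mul_assoc, hm, mul_assoc,
      zpow_mul_of_inverting (inverting_inv h), mul_assoc]⟩

theorem exists_mul_zpow_eq (h : y * x = x * y⁻¹) (a : ℤ) :
    ∃ n : ℤ, (x * y) ^ a = x ^ a * y ^ n := by
  induction a using Int.induction_on with
  | zero => exact ⟨0, by simp⟩
  | succ k ih =>
    obtain ⟨n, hn⟩ := ih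
    refine ⟨-n + 1, ?_⟩
    rw [zpow_add_one, hn, mul_assoc, ← mul_assoc _ x, zpow_mul_of_inverting h, zpow_add_one x,
      zpow_add_one y]
    simp only [mul_assoc]
  | pred k ih =>
    obtain ⟨n, hn⟩ := ih
    refine ⟨-(n - 1), ?_⟩
    rw [zpow_sub_one, hn, mul_inv_rev, mul_assoc, ← mul_assoc _ y⁻¹, ← zpow_sub_one,
      zpow_mul_of_inverting (inverting_inv h), zpow_sub_one x, mul_assoc]

theorem mul_zpow_mul_self (h : y * x = x * y⁻¹) (c : ℤ) :
    (x * y ^ c) * (x * y ^ c) = x * x := by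
  rw [mul_assoc, ← mul_assoc _ x, zpow_mul_of_inverting h, mul_assoc, ← zpow_add]
  simp

end KleinRelation

namespace IsLeftInvariantCone

variable {G : Type*} [Group G] {P : Set G} {x y : G}

theorem mul_mem (hP : IsLeftInvariantCone P) {g k : G} (hg : g ∈ P) (hk : k ∈ P) : g * k ∈ P :=
  hP.1 (Set.mul_mem_mul hg hk)

theorem inv_notMem (hP : IsLeftInvariantCone P) {g : G} (hg : g ∈ P) : g⁻¹ ∉ P := fun h => by
  have : g ∈ P ∩ P⁻¹ := ⟨hg, h⟩
  rwa [hP.2.1] at this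

theorem one_notMem (hP : IsLeftInvariantCone P) : (1 : G) ∉ P := fun h =>
  hP.inv_notMem h (by simpa using h)

theorem mem_or_inv_mem (hP : IsLeftInvariantCone P) {g : G} (hg : g ≠ 1) : g ∈ P ∨ g⁻¹ ∈ P := by
  have : g ∈ P ∪ P⁻¹ := by rw [hP.2.2]; exact hg
  exact this

theorem mul_zpow_mem (hP : IsLeftInvariantCone P) (h : y * x = x * y⁻¹) (hx : x ∈ P) (c : ℤ) :
    x * y ^ c ∈ P := by
  have hsq := mul_zpow_mul_self h c
  have hxx := hP.mul_mem hx hx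
  have hne : x * y ^ c ≠ 1 := fun h1 => hP.one_notMem (by rwa [← hsq, h1, one_mul] at hxx)
  refine (hP.mem_or_inv_mem hne).resolve_right fun hinv => hP.inv_notMem hxx ?_
  rw [← hsq, mul_inv_rev]
  exact hP.mul_mem hinv hinv

theorem pow_succ_mul_zpow_mem (hP : IsLeftInvariantCone P) (h : y * x = x * y⁻¹) (hx : x ∈ P)
    (n : ℕ) (c : ℤ) : x ^ (n + 1) * y ^ c ∈ P := by
  induction n with
  | zero => simpa using hP.mul_zpow_mem h hx c
  | succ n ih =>
    rw [pow_succ', mul_assoc]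
    exact hP.mul_mem hx ih

theorem zpow_mul_zpow_mem_iff_pos (hP : IsLeftInvariantCone P) (h : y * x = x * y⁻¹) (hx : x ∈ P)
    {a : ℤ} (ha : a ≠ 0) (c : ℤ) : x ^ a * y ^ c ∈ P ↔ 0 < a := by
  have hpos : ∀ {b : ℤ}, 0 < b → ∀ c : ℤ, x ^ b * y ^ c ∈ P := fun {b} hb c => by
    obtain ⟨n, rfl⟩ : ∃ n : ℕ, b = (n + 1 : ℕ) := ⟨b.toNat - 1, by omega⟩
    rw [zpow_natCast]
    exact hP.pow_succ_mul_zpow_mem h hx n c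
  refine ⟨fun hm => ?_, fun hb => hpos hb c⟩
  by_contra hneg
  refine hP.inv_notMem hm ?_
  obtain ⟨m, hm'⟩ := exists_zpow_mul_zpow h (-c) (-a)
  rw [mul_inv_rev, ← zpow_neg, ← zpow_neg, hm']
  exact hpos (by omega) m

theorem zpow_mul_zpow_mem_iff (hP : IsLeftInvariantCone P) (h : y * x = x * y⁻¹) (hx : x ≠ 1)
    {a : ℤ} (ha : a ≠ 0) (b c : ℤ) : x ^ a * y ^ b ∈ P ↔ x ^ a * y ^ c ∈ P := by
  rcases hP.mem_or_inv_mem hx with hx | hx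
  · rw [hP.zpow_mul_zpow_mem_iff_pos h hx ha, hP.zpow_mul_zpow_mem_iff_pos h hx ha]
  · have key := fun c => hP.zpow_mul_zpow_mem_iff_pos (inverting_inv h) hx (neg_ne_zero.2 ha) c
    simp only [inv_zpow', neg_neg] at key
    rw [key, key]

end IsLeftInvariantCone

namespace KleinGroup

/-- The generator `x` of the Klein bottle group. -/
def x : KleinGroup := PresentedGroup.of true

/-- The generator `y` of the Klein bottle group. -/
def y : KleinGroup := PresentedGroup.of false

theorem y_mul_x : y * x = x * y⁻¹ := by
  have h : x⁻¹ * y * x * y = 1 :=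
    PresentedGroup.one_of_mem (rels := kleinRels) (Set.mem_singleton _)
  rw [eq_mul_inv_iff_mul_eq]
  simpa [mul_assoc, inv_mul_eq_one, eq_comm] using h

/-- The homomorphism out of the Klein bottle group with prescribed values on the generators. -/
def lift {H : Type*} [Group H] (a b : H) (h : b * a = a * b⁻¹) : KleinGroup →* H :=
  PresentedGroup.toGroup (f := fun i => bif i then a else b) (by
    rintro _ rfl
    simp [mul_assoc, h, ← mul_assoc b a])

section lift

variable {H : Type*} [Group H] (a b : H) (h : b * a = a * b⁻¹)

@[simp] theorem lift_x : lift a b h x = a := PresentedGroup.toGroup.of _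

@[simp] theorem lift_y : lift a b h y = b := PresentedGroup.toGroup.of _

end lift

theorem hom_ext {H : Type*} [Group H] {f g : KleinGroup →* H} (hx : f x = g x) (hy : f y = g y) :
    f = g :=
  PresentedGroup.ext fun i => by cases i <;> assumption

theorem x_ne_one : x ≠ 1 := fun h => by
  have := congrArg (lift (-1 : ℤˣ) 1 (by simp)) h
  rw [lift_x, MonoidHom.map_one] at this
  exact absurd this (by decide)

theorem y_ne_one : y ≠ 1 := fun h => by
  have := congrArg (lift 1 (-1 : ℤˣ) (by simp)) h
  rw [lift_y, MonoidHom.map_one] at this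
  exact absurd this (by decide)

theorem exists_eq_zpow_mul_zpow (g : KleinGroup) : ∃ a b : ℤ, g = x ^ a * y ^ b := by
  have hg : g ∈ Subgroup.closure (Set.range (PresentedGroup.of (rels := kleinRels))) := by
    rw [PresentedGroup.closure_range_of]; trivial
  induction hg using Subgroup.closure_induction with
  | mem g hg =>
    obtain ⟨_ | _, rfl⟩ := hg
    · exact ⟨0, 1, by simp [y]⟩
    · exact ⟨1, 0, by simp [x]⟩
  | one => exact ⟨0, 0, by simp⟩
  | mul g k _ _ hg hk =>
    obtain ⟨a, b, rfl⟩ := hg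
    obtain ⟨c, d, rfl⟩ := hk
    obtain ⟨m, hm⟩ := exists_zpow_mul_zpow y_mul_x b c
    refine ⟨a + c, m + d, ?_⟩
    rw [mul_assoc, ← mul_assoc (y ^ b), hm, zpow_add, zpow_add]
    simp only [mul_assoc]
  | inv g _ hg =>
    obtain ⟨a, b, rfl⟩ := hg
    obtain ⟨m, hm⟩ := exists_zpow_mul_zpow y_mul_x (-b) (-a)
    exact ⟨-a, m, by rw [← hm, mul_inv_rev, zpow_neg, zpow_neg]⟩

/-- The automorphism of the Klein bottle group fixing `y` and sending `x` to `x * y`. -/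
def shear : KleinGroup ≃* KleinGroup :=
  MonoidHom.toMulEquiv
    (lift (x * y) y (by rw [← mul_assoc, y_mul_x]; simp))
    (lift (x * y⁻¹) y (by rw [← mul_assoc, y_mul_x]))
    (hom_ext (by simp) (by simp))
    (hom_ext (by simp) (by simp))

@[simp] theorem shear_x : shear x = x * y := by simp [shear]

@[simp] theorem shear_y : shear y = y := by simp [shear]

theorem shear_mem_iff {P : Set KleinGroup} (hP : IsLeftInvariantCone P) (g : KleinGroup) :
    shear g ∈ P ↔ g ∈ P := by
  obtain ⟨a, b, rfl⟩ := exists_eq_zpow_mul_zpow g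
  rcases eq_or_ne a 0 with rfl | ha
  · simp
  · obtain ⟨n, hn⟩ := exists_mul_zpow_eq y_mul_x a
    rw [map_mul, map_zpow, map_zpow, shear_x, shear_y, hn, mul_assoc, ← zpow_add]
    exact hP.zpow_mul_zpow_mem_iff y_mul_x x_ne_one ha _ _

end KleinGroup

/-- `Aut(K)` does not act faithfully on the set of left-invariant positive cones of the
Klein bottle group `K`. -/
theorem klein_aut_not_faithful_on_left_orderings :
    ∃ φ : KleinGroup ≃* KleinGroup, φ ≠ MulEquiv.refl KleinGroup ∧
      ∀ P : Set KleinGroup, IsLeftInvariantCone P → ⇑φ '' P = P := by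
  refine ⟨KleinGroup.shear, fun h => KleinGroup.y_ne_one ?_, fun P hP => ?_⟩
  · simpa using DFunLike.congr_fun h KleinGroup.x
  · have hpre : KleinGroup.shear ⁻¹' P = P := Set.ext (KleinGroup.shear_mem_iff hP)
    conv_lhs => rw [← hpre]
    exact Set.image_preimage_eq P KleinGroup.shear.surjective
end
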